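/- In the setting of the distortion D(y) := Σ_{i∈I} Σ_{u∈U} p_{i,u} · E[ min_{1 ≤ v ≤ N} (m_{i,u} Z + c_u − y_v)² ] on {y ∈ ℝ^N : y₁ < ⋯ < y_N}, with region boundaries R_v^± and standardized boundaries r_{i,u,v}^± = (R_v^± − c_u)/m_{i,u} as above, D is twice partially differentiable and for each 1 ≤ v ≤ N the diagonal entry of the Hessian is ∂²D/∂(y_v)² = Σ_{i∈I} Σ_{u∈U} p_{i,u} [ 2 sgn(m_{i,u})(F_Z(r_{i,u,v}^+) − F_Z(r_{i,u,v}^−)) + (1/(2|m_{i,u}|)) φ(r_{i,u,v}^+)(y_v − y_{v+1}) + (1/(2|m_{i,u}|)) φ(r_{i,u,v}^−)(y_{v−1} − y_v) ], where terms involving an infinite standardized boundary vanish via the convention φ(±∞) = 0 (so the y_{v+1}-term is absent for v = N and the y_{v−1}-term is absent for v = 1). -/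

import Mathlib

open MeasureTheory ProbabilityTheory

/-- standard normal density `φ(t) = exp(−t²/2)/√(2π)` -/
noncomputable def stdPhi (t : ℝ) : ℝ := Real.exp (-t ^ 2 / 2) / Real.sqrt (2 * Real.pi)

/-- standard normal cumulative distribution function `F_Z` -/
noncomputable def stdCDF (z : ℝ) : ℝ := ∫ t in Set.Iic z, stdPhi t

/-- `F_Z` extended to the extended reals by `F_Z(−∞) = 0`, `F_Z(+∞) = 1`. -/
noncomputable def stdCDFE (x : EReal) : ℝ :=
  if x = ⊥ then 0 else if x = ⊤ then 1 else stdCDF x.toReal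

/-- `φ` extended to the extended reals by `φ(±∞) = 0`. -/
noncomputable def stdPhiE (x : EReal) : ℝ :=
  if x = ⊥ then 0 else if x = ⊤ then 0 else stdPhi x.toReal

/-- Upper region boundary `R_v^+ = (y_v + y_{v+1})/2`, with `R_N^+ = +∞`. -/
noncomputable def Rplus {N : ℕ} (y : Fin N → ℝ) (v : Fin N) : EReal :=
  if h : (v : ℕ) + 1 < N then (((y v + y ⟨(v : ℕ) + 1, h⟩) / 2 : ℝ) : EReal) else ⊤

/-- Lower region boundary `R_v^− = (y_{v−1} + y_v)/2`, with `R_1^− = −∞`. -/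
noncomputable def Rminus {N : ℕ} (y : Fin N → ℝ) (v : Fin N) : EReal :=
  if 0 < (v : ℕ) then
    (((y ⟨(v : ℕ) - 1, Nat.lt_of_le_of_lt (Nat.sub_le _ _) v.isLt⟩ + y v) / 2 : ℝ) : EReal)
  else ⊥

/-- Standardized boundary `r = (R − c)/m` in the extended reals, with the sign of an
infinite boundary determined by the sign of `m`. -/
noncomputable def stdBoundary (R : EReal) (c m : ℝ) : EReal :=
  if R = ⊤ then (if 0 < m then ⊤ else ⊥)
  else if R = ⊥ then (if 0 < m then ⊥ else ⊤)
  else (((R.toReal - c) / m : ℝ) : EReal)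

/-- The neighbouring codeword `y_{v+1}` (junk value `0` when `v = N`, where the
corresponding term is killed by `φ(±∞) = 0`). -/
noncomputable def ynext {N : ℕ} (y : Fin N → ℝ) (v : Fin N) : ℝ :=
  if h : (v : ℕ) + 1 < N then y ⟨(v : ℕ) + 1, h⟩ else 0

/-- The neighbouring codeword `y_{v−1}` (junk value `0` when `v = 1`, where the
corresponding term is killed by `φ(±∞) = 0`). -/
noncomputable def yprev {N : ℕ} (y : Fin N → ℝ) (v : Fin N) : ℝ :=
  if 0 < (v : ℕ) then y ⟨(v : ℕ) - 1, Nat.lt_of_le_of_lt (Nat.sub_le _ _) v.isLt⟩ else 0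

open Filter Topology Set

section QuantizationError

variable {N : ℕ}

lemma tendsto_update_apply (y : Fin N → ℝ) (v w : Fin N) :
    Tendsto (fun t => Function.update y v t w) (𝓝 (y v)) (𝓝 (y w)) := by
  have h : Continuous fun t : ℝ => Function.update y v t w :=
    (continuous_apply w).comp
      ((continuous_const (y := y)).update v continuous_id : Continuous (Function.update y v))
  simpa using h.tendsto (y v)

lemma eventually_strictMono_update {y : Fin N → ℝ} (hy : StrictMono y) (v : Fin N) :
    ∀ᶠ t in 𝓝 (y v), StrictMono (Function.update y v t) := by
  have h : ∀ᶠ t in 𝓝 (y v), ∀ i j : Fin N, i < j →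
      Function.update y v t i < Function.update y v t j := by
    refine eventually_all.2 fun i => eventually_all.2 fun j => ?_
    by_cases hij : i < j
    · filter_upwards [(tendsto_update_apply y v i).eventually_lt
        (tendsto_update_apply y v j) (hy hij)] with t ht _ using ht
    · exact Eventually.of_forall fun t h => absurd h hij
  exact h

/-- The open Voronoi cell of the codeword `y v`. -/
def openCell (y : Fin N → ℝ) (v : Fin N) : Set ℝ :=
  {x | ∀ k, k ≠ v → (x - y v) ^ 2 < (x - y k) ^ 2}

lemma measurableSet_openCell (y : Fin N → ℝ) (v : Fin N) : MeasurableSet (openCell y v) := by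
  have h : openCell y v = ⋂ k, ⋂ (_ : k ≠ v), {x | (x - y v) ^ 2 < (x - y k) ^ 2} := by
    ext x; simp [openCell]
  rw [h]
  exact MeasurableSet.iInter fun k => MeasurableSet.iInter fun _ =>
    measurableSet_lt (by fun_prop) (by fun_prop)

lemma iInf_le_of_finite (f : Fin N → ℝ) (k : Fin N) : ⨅ w, f w ≤ f k :=
  ciInf_le (Set.finite_range f).bddBelow k

/-- Off the midpoints between codewords, the pointwise quantization error is differentiable
in each codeword. -/
lemma hasDerivAt_iInf_sq_update (y : Fin N → ℝ) (v : Fin N) {x : ℝ}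
    (hx : ∀ k, k ≠ v → (x - y v) ^ 2 ≠ (x - y k) ^ 2) :
    HasDerivAt (fun t => ⨅ w, (x - Function.update y v t w) ^ 2)
      ((openCell y v).indicator (fun x => 2 * (y v - x)) x) (y v) := by
  have : Nonempty (Fin N) := ⟨v⟩
  have hself : Tendsto (fun t => (x - t) ^ 2) (𝓝 (y v)) (𝓝 ((x - y v) ^ 2)) :=
    (by fun_prop : Continuous fun t : ℝ => (x - t) ^ 2).tendsto _
  by_cases hmem : x ∈ openCell y v
  · rw [indicator_of_mem hmem]
    have hev : (fun t => ⨅ w, (x - Function.update y v t w) ^ 2) =ᶠ[𝓝 (y v)]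
        fun t => (x - t) ^ 2 := by
      have h : ∀ᶠ t in 𝓝 (y v), ∀ k, k ≠ v → (x - t) ^ 2 < (x - y k) ^ 2 := by
        refine eventually_all.2 fun k => ?_
        by_cases hk : k = v
        · exact Eventually.of_forall fun t h => absurd hk h
        · filter_upwards [hself.eventually_lt_const (hmem k hk)] with t ht _ using ht
      filter_upwards [h] with t ht
      refine le_antisymm ((iInf_le_of_finite _ v).trans_eq (by simp)) (le_ciInf fun w => ?_)
      by_cases hw : w = v
      · simp [hw]
      · simpa [hw] using (ht w hw).le
    refine HasDerivAt.congr_of_eventuallyEq ?_ hev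
    exact (((hasDerivAt_id' (y v)).const_sub x).pow 2).congr_deriv (by norm_num; ring)
  · rw [indicator_of_notMem hmem]
    obtain ⟨k, hk, hlt⟩ : ∃ k, k ≠ v ∧ (x - y k) ^ 2 < (x - y v) ^ 2 := by
      simp only [openCell, mem_ofPred_eq, not_forall, not_lt] at hmem
      obtain ⟨k, hk, h⟩ := hmem
      exact ⟨k, hk, lt_of_le_of_ne h (hx k hk).symm⟩
    have hev : (fun t => ⨅ w, (x - Function.update y v t w) ^ 2) =ᶠ[𝓝 (y v)]
        fun _ => ⨅ w, (x - Function.update y v (y k) w) ^ 2 := by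
      filter_upwards [hself.eventually_const_lt hlt] with t ht
      refine le_antisymm (le_ciInf fun w => ?_) (le_ciInf fun w => ?_)
      · by_cases hw : w = v
        · exact (iInf_le_of_finite _ k).trans_eq (by simp [hw, hk])
        · exact (iInf_le_of_finite _ w).trans_eq (by simp [hw])
      · by_cases hw : w = v
        · exact (iInf_le_of_finite _ k).trans (by simpa [hw, hk] using ht.le)
        · exact (iInf_le_of_finite _ w).trans_eq (by simp [hw])
    exact (hasDerivAt_const _ _).congr_of_eventuallyEq hev

lemma abs_iInf_sub_iInf_le [Nonempty (Fin N)] {f g : Fin N → ℝ} {C : ℝ}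
    (h : ∀ w, |f w - g w| ≤ C) : |(⨅ w, f w) - ⨅ w, g w| ≤ C := by
  have key : ∀ f g : Fin N → ℝ, (∀ w, |f w - g w| ≤ C) → (⨅ w, f w) - C ≤ ⨅ w, g w :=
    fun f g h => le_ciInf fun w => by
      linarith [iInf_le_of_finite f w, (abs_le.1 (h w)).2]
  have h₁ := key f g h
  have h₂ := key g f fun w => by rw [abs_sub_comm]; exact h w
  exact abs_le.2 ⟨by linarith, by linarith⟩

lemma lipschitzOnWith_iInf_sq_update (y : Fin N → ℝ) (v : Fin N) (x : ℝ) :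
    LipschitzOnWith (Real.nnabs (2 * (|x - y v| + 1)))
      (fun t => ⨅ w, (x - Function.update y v t w) ^ 2) (Metric.ball (y v) 1) := by
  have : Nonempty (Fin N) := ⟨v⟩
  refine LipschitzOnWith.of_dist_le_mul fun s hs t ht => ?_
  have hC : 0 ≤ 2 * (|x - y v| + 1) := by positivity
  rw [Real.dist_eq, Real.dist_eq, Real.coe_nnabs, abs_of_nonneg hC]
  refine abs_iInf_sub_iInf_le fun w => ?_
  by_cases hw : w = v
  · subst hw
    rw [Metric.mem_ball, Real.dist_eq] at hs ht
    have hfac : (x - s) ^ 2 - (x - t) ^ 2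
        = (2 * (x - y w) - (s - y w) - (t - y w)) * (t - s) := by ring
    rw [Function.update_self, Function.update_self, hfac, abs_mul, abs_sub_comm t s]
    gcongr
    calc |2 * (x - y w) - (s - y w) - (t - y w)|
        ≤ |2 * (x - y w)| + |s - y w| + |t - y w| :=
          (abs_sub _ _).trans (by gcongr; exact abs_sub _ _)
      _ ≤ 2 * (|x - y w| + 1) := by rw [abs_mul, abs_two]; linarith
  · simp only [ne_eq, hw, not_false_eq_true, Function.update_of_ne, sub_self, abs_zero]
    positivity

/-- Differentiation of the quantization error under the integral sign. -/
lemma hasDerivAt_integral_iInf_sq_update (μ : Measure ℝ) [IsFiniteMeasure μ]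
    [NullSingletonClass μ] (hμ : MemLp id 2 μ) {y : Fin N → ℝ} (hy : StrictMono y)
    (v : Fin N) :
    HasDerivAt (fun t => ∫ x, ⨅ w, (x - Function.update y v t w) ^ 2 ∂μ)
      (∫ x in openCell y v, 2 * (y v - x) ∂μ) (y v) := by
  have hsub : MemLp (fun x => x - y v) 2 μ := hμ.sub (memLp_const (y v))
  have hmeas : ∀ t, Measurable fun x => ⨅ w, (x - Function.update y v t w) ^ 2 := fun t =>
    Measurable.iInf fun w => by fun_prop
  have hint : Integrable (fun x => ⨅ w, (x - Function.update y v (y v) w) ^ 2) μ := by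
    refine hsub.integrable_sq.mono' (hmeas _).aestronglyMeasurable (ae_of_all _ fun x => ?_)
    rw [Real.norm_eq_abs, abs_of_nonneg (Real.iInf_nonneg fun w => sq_nonneg _)]
    exact (iInf_le_of_finite _ v).trans_eq (by simp)
  have hbound : Integrable (fun x => 2 * (|x - y v| + 1)) μ :=
    (((hsub.integrable one_le_two).abs).add (integrable_const 1)).const_mul 2
  have hae : ∀ᵐ x ∂μ, ∀ k, k ≠ v → (x - y v) ^ 2 ≠ (x - y k) ^ 2 := by
    refine ae_all_iff.2 fun k => ?_
    by_cases hk : k = v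
    · exact ae_of_all _ fun x h => absurd hk h
    · filter_upwards [(Set.countable_singleton ((y v + y k) / 2)).ae_notMem μ] with x hx _ h
      have hne : y v - y k ≠ 0 := sub_ne_zero.2 fun h => hk (hy.injective h).symm
      have : (y v - y k) * (x - (y v + y k) / 2) = 0 := by linear_combination (-1 / 2) * h
      exact hx (sub_eq_zero.1 ((mul_eq_zero.1 this).resolve_left hne))
  have h := hasDerivAt_integral_of_dominated_loc_of_lip
    (F' := (openCell y v).indicator fun x => 2 * (y v - x))
    (Metric.ball_mem_nhds (y v) one_pos)
    (Eventually.of_forall fun t => (hmeas t).aestronglyMeasurable) hint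
    ((Measurable.indicator (by fun_prop) (measurableSet_openCell y v)).aestronglyMeasurable)
    (ae_of_all _ fun x => lipschitzOnWith_iInf_sq_update y v x) hbound
    (hae.mono fun x hx => hasDerivAt_iInf_sq_update y v hx)
  rw [← integral_indicator (measurableSet_openCell y v)]
  exact h.2

lemma sq_sub_lt_sq_sub_iff_of_lt {x a b : ℝ} (h : a < b) :
    (x - a) ^ 2 < (x - b) ^ 2 ↔ x < (a + b) / 2 := by
  constructor <;> intro h' <;> nlinarith

lemma sq_sub_lt_sq_sub_iff_of_gt {x a b : ℝ} (h : b < a) :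
    (x - a) ^ 2 < (x - b) ^ 2 ↔ (b + a) / 2 < x := by
  constructor <;> intro h' <;> nlinarith

lemma openCell_eq {y : Fin N → ℝ} (hy : StrictMono y) (v : Fin N) :
    openCell y v = {x : ℝ | Rminus y v < (x : EReal) ∧ (x : EReal) < Rplus y v} := by
  ext x
  simp only [openCell, mem_ofPred_eq]
  constructor
  · intro h
    constructor
    · unfold Rminus
      split_ifs with hv
      · have hlt : (⟨(v : ℕ) - 1, Nat.lt_of_le_of_lt (Nat.sub_le _ _) v.isLt⟩ : Fin N) < v :=
          Fin.lt_def.2 (by simp; omega)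
        exact EReal.coe_lt_coe_iff.2 ((sq_sub_lt_sq_sub_iff_of_gt (hy hlt)).1 (h _ hlt.ne))
      · exact EReal.bot_lt_coe x
    · unfold Rplus
      split_ifs with hv
      · have hlt : v < (⟨(v : ℕ) + 1, hv⟩ : Fin N) := Fin.lt_def.2 (by simp)
        exact EReal.coe_lt_coe_iff.2 ((sq_sub_lt_sq_sub_iff_of_lt (hy hlt)).1 (h _ hlt.ne'))
      · exact EReal.coe_lt_top x
  · rintro ⟨h₁, h₂⟩ k hk
    rcases lt_or_gt_of_ne hk with hlt | hlt
    · rw [sq_sub_lt_sq_sub_iff_of_gt (hy hlt)]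
      have hv : 0 < (v : ℕ) := by have := Fin.lt_def.1 hlt; omega
      rw [Rminus, if_pos hv, EReal.coe_lt_coe_iff] at h₁
      have := hy.monotone (show k ≤ ⟨(v : ℕ) - 1, Nat.lt_of_le_of_lt (Nat.sub_le _ _) v.isLt⟩ from
        Fin.le_def.2 (by have := Fin.lt_def.1 hlt; simp; omega))
      linarith
    · rw [sq_sub_lt_sq_sub_iff_of_lt (hy hlt)]
      have hv : (v : ℕ) + 1 < N := by have := Fin.lt_def.1 hlt; omega
      rw [Rplus, dif_pos hv, EReal.coe_lt_coe_iff] at h₂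
      have := hy.monotone (show (⟨(v : ℕ) + 1, hv⟩ : Fin N) ≤ k from
        Fin.le_def.2 (by have := Fin.lt_def.1 hlt; simp; omega))
      linarith

lemma Rminus_le_Rplus {y : Fin N → ℝ} (hy : StrictMono y) (v : Fin N) :
    Rminus y v ≤ Rplus y v := by
  have h : y v ∈ openCell y v := fun k hk => by
    have : y v - y k ≠ 0 := sub_ne_zero.2 fun h => hk (hy.injective h).symm
    rw [sub_self, zero_pow two_ne_zero]; positivity
  rw [openCell_eq hy] at h
  exact (h.1.trans h.2).le

lemma measurableSet_coe_lt (R : EReal) : MeasurableSet {x : ℝ | (x : EReal) < R} :=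
  measurableSet_lt measurable_coe_real_ereal measurable_const

lemma setIntegral_openCell (μ : Measure ℝ) [NullSingletonClass μ] {y : Fin N → ℝ}
    (hy : StrictMono y) (v : Fin N) {f : ℝ → ℝ} (hf : Integrable f μ) :
    ∫ x in openCell y v, f x ∂μ
      = ∫ x in {x : ℝ | (x : EReal) < Rplus y v}, f x ∂μ
        - ∫ x in {x : ℝ | (x : EReal) < Rminus y v}, f x ∂μ := by
  have hsub : {x : ℝ | (x : EReal) < Rminus y v} ⊆ {x : ℝ | (x : EReal) < Rplus y v} :=
    fun x hx => lt_of_lt_of_le hx (Rminus_le_Rplus hy v)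
  rw [← setIntegral_sdiff (measurableSet_coe_lt _) hf.integrableOn hsub]
  refine setIntegral_congr_set ?_
  rw [openCell_eq hy]
  filter_upwards [(Set.countable_singleton (Rminus y v).toReal).ae_notMem μ] with x hx
  refine propext ⟨fun h => ⟨h.2, not_lt.2 h.1.le⟩, fun h => ⟨?_, h.1⟩⟩
  refine lt_of_le_of_ne (not_lt.1 h.2) fun h' => hx ?_
  simp [h']

end QuantizationError

section Gaussian

lemma gaussianPDFReal_zero_one : gaussianPDFReal 0 1 = stdPhi := by
  ext t
  simp [gaussianPDFReal, stdPhi, div_eq_inv_mul]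

lemma hasDerivAt_stdPhi (t : ℝ) : HasDerivAt stdPhi (-t * stdPhi t) t := by
  have h : HasDerivAt stdPhi _ t :=
    ((((hasDerivAt_id' t).pow 2).neg.div_const 2).exp).div_const (Real.sqrt (2 * Real.pi))
  exact h.congr_deriv (by simp only [stdPhi]; norm_num; ring)

lemma continuous_stdPhi : Continuous stdPhi :=
  continuous_iff_continuousAt.2 fun t => (hasDerivAt_stdPhi t).continuousAt

lemma integrable_stdPhi : Integrable stdPhi := by
  rw [← gaussianPDFReal_zero_one]
  exact integrable_gaussianPDFReal 0 1

lemma hasDerivAt_stdCDF (z : ℝ) : HasDerivAt stdCDF (stdPhi z) z := by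
  have h : stdCDF = fun z => (∫ t in (0 : ℝ)..z, stdPhi t) + stdCDF 0 := by
    ext z
    rw [← intervalIntegral.integral_Iic_sub_Iic integrable_stdPhi.integrableOn
      integrable_stdPhi.integrableOn, stdCDF, stdCDF]
    ring
  rw [h]
  exact (intervalIntegral.integral_hasDerivAt_right (continuous_stdPhi.intervalIntegrable _ _)
    (continuous_stdPhi.stronglyMeasurableAtFilter _ _) continuous_stdPhi.continuousAt).add_const _

lemma tendsto_stdPhi_atBot : Tendsto stdPhi atBot (𝓝 0) := by
  have h₁ : Tendsto (fun t : ℝ => t ^ 2 / 2) atBot atTop :=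
    ((tendsto_pow_atTop two_ne_zero).comp tendsto_abs_atBot_atTop).atTop_div_const two_pos
      |>.congr fun t => by simp
  have h₂ := (Real.tendsto_exp_neg_atTop_nhds_zero.comp h₁).div_const (Real.sqrt (2 * Real.pi))
  rw [zero_div] at h₂
  exact h₂.congr fun t => by simp [stdPhi, neg_div]

lemma integrable_affine_gaussianReal (a m : ℝ) :
    Integrable (fun z => a - m * z) (gaussianReal 0 1) :=
  (integrable_const a).sub
    (((memLp_id_gaussianReal (μ := 0) (v := 1) 1).integrable le_rfl).const_mul m)

lemma integrable_mul_stdPhi : Integrable fun z : ℝ => z * stdPhi z := by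
  have h := (integrable_mul_exp_neg_mul_sq (b := 1 / 2) (by norm_num)).div_const
    (Real.sqrt (2 * Real.pi))
  refine h.congr (ae_of_all _ fun z => ?_)
  simp only [stdPhi]
  rw [mul_div_assoc]
  congr 3
  ring

lemma setIntegral_coe_lt_gaussianReal (a m : ℝ) (r : EReal) :
    ∫ z in {z : ℝ | (z : EReal) < r}, (a - m * z) ∂gaussianReal 0 1
      = a * stdCDFE r + m * stdPhiE r := by
  induction r with
  | bot => simp [stdCDFE, stdPhiE]
  | top =>
    have h := integral_sub (integrable_const (μ := gaussianReal 0 1) a)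
      (((memLp_id_gaussianReal (μ := 0) (v := 1) 1).integrable le_rfl).const_mul m)
    simp only [id] at h
    rw [integral_const_mul, integral_id_gaussianReal] at h
    simp [stdCDFE, stdPhiE, EReal.coe_lt_top, h]
  | coe r =>
    have hset : {z : ℝ | (z : EReal) < r} = Iio r := by ext; simp
    have hlim : ∫ z in Iic r, -z * stdPhi z = stdPhi r := by
      simpa using integral_Iic_of_hasDerivAt_of_tendsto' (fun z _ => hasDerivAt_stdPhi z)
        ((integrable_mul_stdPhi.neg.congr (ae_of_all _ fun z => by simp)).integrableOn)
        tendsto_stdPhi_atBot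
    rw [hset, ← integral_indicator measurableSet_Iio,
      integral_gaussianReal_eq_integral_smul one_ne_zero, gaussianPDFReal_zero_one]
    have hcongr : (fun z => stdPhi z • (Iio r).indicator (fun z => a - m * z) z)
        = (Iio r).indicator fun z => a * stdPhi z + m * (-z * stdPhi z) := by
      ext z
      by_cases hz : z ∈ Iio r
      · simp only [indicator_of_mem hz, smul_eq_mul]; ring
      · simp [indicator_of_notMem hz]
    rw [hcongr, integral_indicator measurableSet_Iio, ← integral_Iic_eq_integral_Iio,
      integral_add (integrable_stdPhi.const_mul a).integrableOn
        ((integrable_mul_stdPhi.neg.congr (ae_of_all _ fun z => by simp)).const_mul m).integrableOn,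
      integral_const_mul, integral_const_mul, hlim]
    simp [stdCDFE, stdPhiE, stdCDF]

lemma coe_affine_lt_iff_of_pos {m : ℝ} (hm : 0 < m) (c z : ℝ) (R : EReal) :
    ((m * z + c : ℝ) : EReal) < R ↔ (z : EReal) < stdBoundary R c m := by
  induction R with
  | bot => simp [stdBoundary, hm]
  | top => simp [stdBoundary, hm, EReal.coe_lt_top, -EReal.coe_add, -EReal.coe_mul]
  | coe R =>
    simp only [stdBoundary, EReal.coe_ne_top, EReal.coe_ne_bot, if_false, EReal.toReal_coe,
      EReal.coe_lt_coe_iff, lt_div_iff₀ hm]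
    constructor <;> intro h <;> linarith

lemma coe_affine_lt_iff_of_neg {m : ℝ} (hm : m < 0) (c z : ℝ) (R : EReal) :
    ((m * z + c : ℝ) : EReal) < R ↔ stdBoundary R c m < (z : EReal) := by
  induction R with
  | bot => simp [stdBoundary, hm.not_gt]
  | top => simp [stdBoundary, hm.not_gt, EReal.coe_lt_top, EReal.bot_lt_coe, -EReal.coe_add,
      -EReal.coe_mul]
  | coe R =>
    simp only [stdBoundary, EReal.coe_ne_top, EReal.coe_ne_bot, if_false, EReal.toReal_coe,
      EReal.coe_lt_coe_iff, div_lt_iff_of_neg hm]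
    constructor <;> intro h <;> linarith

lemma setIntegral_affine_coe_lt_gaussianReal {m : ℝ} (hm : m ≠ 0) (a c : ℝ) (R : EReal) :
    ∫ z in {z : ℝ | ((m * z + c : ℝ) : EReal) < R}, (a - m * z) ∂gaussianReal 0 1
      = Real.sign m * (a * stdCDFE (stdBoundary R c m) + m * stdPhiE (stdBoundary R c m))
        + if m < 0 then a else 0 := by
  rcases lt_or_gt_of_ne hm with hneg | hpos
  · have := nullSingletonClass_gaussianReal (μ := 0) (v := 1) one_ne_zero
    set r := stdBoundary R c m
    have hmeas : MeasurableSet {z : ℝ | (z : EReal) < r} :=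
      measurableSet_lt measurable_coe_real_ereal measurable_const
    have hset : ({z : ℝ | ((m * z + c : ℝ) : EReal) < R} : Set ℝ)
        =ᵐ[gaussianReal 0 1] ({z : ℝ | (z : EReal) < r}ᶜ : Set ℝ) := by
      filter_upwards [(Set.countable_singleton r.toReal).ae_notMem _] with z hz
      refine propext ((coe_affine_lt_iff_of_neg hneg c z R).trans
        ⟨fun h => not_lt.2 h.le, fun h => lt_of_le_of_ne (not_lt.1 h) fun h' => hz ?_⟩)
      simp [r, h']
    have htot := setIntegral_coe_lt_gaussianReal a m ⊤
    have hcompl := integral_add_compl hmeas (integrable_affine_gaussianReal a m)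
    simp only [EReal.coe_lt_top, ofPred_true, setIntegral_univ, stdCDFE, stdPhiE, top_ne_bot,
      if_false, if_true, mul_one, mul_zero, add_zero] at htot
    rw [setIntegral_coe_lt_gaussianReal, htot] at hcompl
    rw [setIntegral_congr_set hset, Real.sign_of_neg hneg, if_pos hneg,
      eq_sub_of_add_eq' hcompl]
    ring
  · simp_rw [coe_affine_lt_iff_of_pos hpos]
    rw [setIntegral_coe_lt_gaussianReal, Real.sign_of_pos hpos, if_neg hpos.not_gt]
    ring

end Gaussian

section Distortion

variable {N : ℕ}

/-- The first partial derivative of the Gaussian quantization error. -/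
lemma hasDerivAt_gaussian_distortion {m : ℝ} (hm : m ≠ 0) (c : ℝ) {y : Fin N → ℝ}
    (hy : StrictMono y) (v : Fin N) :
    HasDerivAt
      (fun t => ∫ z, ⨅ w, (m * z + c - Function.update y v t w) ^ 2 ∂gaussianReal 0 1)
      (2 * Real.sign m *
        (((y v - c) * stdCDFE (stdBoundary (Rplus y v) c m)
            + m * stdPhiE (stdBoundary (Rplus y v) c m))
          - ((y v - c) * stdCDFE (stdBoundary (Rminus y v) c m)
            + m * stdPhiE (stdBoundary (Rminus y v) c m)))) (y v) := by
  have hA : Measurable fun z : ℝ => m * z + c := by fun_prop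
  set μ := (gaussianReal 0 1).map fun z => m * z + c with hμ
  have hlaw : ∃ s : NNReal, s ≠ 0 ∧ μ = gaussianReal c s := by
    refine ⟨NNReal.mk (m ^ 2) (sq_nonneg m), fun h => pow_ne_zero 2 hm (congrArg NNReal.toReal h), ?_⟩
    have h : μ = ((gaussianReal 0 1).map (m * ·)).map (· + c) := by
      rw [Measure.map_map (by fun_prop) (by fun_prop)]; rfl
    rw [h, gaussianReal_map_const_mul, gaussianReal_map_add_const]
    simp
  obtain ⟨s, hs, hμs⟩ := hlaw
  have hprob : IsProbabilityMeasure μ := by rw [hμs]; infer_instance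
  have hnull : NullSingletonClass μ := by rw [hμs]; exact nullSingletonClass_gaussianReal hs
  have hmem : MemLp id 2 μ := by rw [hμs]; exact memLp_id_gaussianReal' 2 (by simp)
  have hhalf : ∀ R : EReal, ∫ x in {x : ℝ | (x : EReal) < R}, 2 * (y v - x) ∂μ
      = 2 * (Real.sign m * ((y v - c) * stdCDFE (stdBoundary R c m)
        + m * stdPhiE (stdBoundary R c m)) + if m < 0 then y v - c else 0) := by
    intro R
    rw [hμ, setIntegral_map (measurableSet_coe_lt R) (by fun_prop) hA.aemeasurable,
      integral_const_mul, ← setIntegral_affine_coe_lt_gaussianReal hm]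
    congr 1
    refine integral_congr_ae (ae_of_all _ fun z => ?_)
    simp only
    ring
  have hint : Integrable (fun x => 2 * (y v - x)) μ :=
    ((integrable_const (y v)).sub (hmem.integrable one_le_two)).const_mul 2
  have h := hasDerivAt_integral_iInf_sq_update μ hmem hy v
  rw [setIntegral_openCell μ hy v hint, hhalf, hhalf] at h
  refine (h.congr_deriv (by ring)).congr_of_eventuallyEq (Eventually.of_forall fun t => ?_)
  have hmeas : Measurable fun x => ⨅ w, (x - Function.update y v t w) ^ 2 :=
    Measurable.iInf fun w => by fun_prop
  exact (integral_map hA.aemeasurable hmeas.aestronglyMeasurable).symm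

lemma stdCDFE_coe (x : ℝ) : stdCDFE x = stdCDF x := by simp [stdCDFE]

lemma stdPhiE_coe (x : ℝ) : stdPhiE x = stdPhi x := by simp [stdPhiE]

lemma stdBoundary_coe (R c m : ℝ) : stdBoundary R c m = (((R - c) / m : ℝ) : EReal) := by
  simp [stdBoundary]

lemma stdPhiE_stdBoundary_top (c m : ℝ) : stdPhiE (stdBoundary ⊤ c m) = 0 := by
  by_cases h : 0 < m <;> simp [stdPhiE, stdBoundary, h]

lemma stdPhiE_stdBoundary_bot (c m : ℝ) : stdPhiE (stdBoundary ⊥ c m) = 0 := by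
  by_cases h : 0 < m <;> simp [stdPhiE, stdBoundary, h]

lemma hasDerivAt_boundary_term {m : ℝ} (hm : m ≠ 0) (b c t : ℝ) :
    HasDerivAt (fun t => (t - c) * stdCDF (((t + b) / 2 - c) / m)
        + m * stdPhi (((t + b) / 2 - c) / m))
      (stdCDF (((t + b) / 2 - c) / m)
        + stdPhi (((t + b) / 2 - c) / m) * (t - b) / (4 * m)) t := by
  have hr : HasDerivAt (fun t : ℝ => ((t + b) / 2 - c) / m) (1 / 2 / m) t :=
    ((((hasDerivAt_id' t).add_const b).div_const 2).sub_const c).div_const m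
  have h := (((hasDerivAt_id' t).sub_const c).mul ((hasDerivAt_stdCDF _).comp t hr)).add
    (((hasDerivAt_stdPhi _).comp t hr).const_mul m)
  refine h.congr_deriv ?_
  simp only [Function.comp_apply]
  field_simp
  ring

lemma hasDerivAt_Rplus_term {m : ℝ} (hm : m ≠ 0) (c : ℝ) (y : Fin N → ℝ) (v : Fin N) :
    HasDerivAt (fun t => (t - c) * stdCDFE (stdBoundary (Rplus (Function.update y v t) v) c m)
        + m * stdPhiE (stdBoundary (Rplus (Function.update y v t) v) c m))
      (stdCDFE (stdBoundary (Rplus y v) c m)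
        + stdPhiE (stdBoundary (Rplus y v) c m) * (y v - ynext y v) / (4 * m)) (y v) := by
  by_cases hv : (v : ℕ) + 1 < N
  · have hne : (⟨(v : ℕ) + 1, hv⟩ : Fin N) ≠ v := fun h => by simpa using congrArg Fin.val h
    simp only [Rplus, ynext, dif_pos hv, stdBoundary_coe, stdCDFE_coe, stdPhiE_coe,
      Function.update_self, Function.update_of_ne hne]
    exact hasDerivAt_boundary_term hm _ c (y v)
  · simp only [Rplus, dif_neg hv, stdPhiE_stdBoundary_top, mul_zero, zero_mul, zero_div, add_zero]
    simpa using ((hasDerivAt_id' (y v)).sub_const c).mul_const (stdCDFE (stdBoundary ⊤ c m))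

lemma hasDerivAt_Rminus_term {m : ℝ} (hm : m ≠ 0) (c : ℝ) (y : Fin N → ℝ) (v : Fin N) :
    HasDerivAt (fun t => (t - c) * stdCDFE (stdBoundary (Rminus (Function.update y v t) v) c m)
        + m * stdPhiE (stdBoundary (Rminus (Function.update y v t) v) c m))
      (stdCDFE (stdBoundary (Rminus y v) c m)
        + stdPhiE (stdBoundary (Rminus y v) c m) * (y v - yprev y v) / (4 * m)) (y v) := by
  by_cases hv : 0 < (v : ℕ)
  · have hne : (⟨(v : ℕ) - 1, Nat.lt_of_le_of_lt (Nat.sub_le _ _) v.isLt⟩ : Fin N) ≠ v :=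
      fun h => by have := congrArg Fin.val h; simp at this; omega
    simp only [Rminus, yprev, if_pos hv, stdBoundary_coe, stdCDFE_coe, stdPhiE_coe,
      Function.update_self, Function.update_of_ne hne]
    simp only [add_comm (y ⟨(v : ℕ) - 1, _⟩)]
    exact hasDerivAt_boundary_term hm _ c (y v)
  · simp only [Rminus, if_neg hv, stdPhiE_stdBoundary_bot, mul_zero, zero_mul, zero_div, add_zero]
    simpa using ((hasDerivAt_id' (y v)).sub_const c).mul_const (stdCDFE (stdBoundary ⊥ c m))

/-- The second partial derivative of the Gaussian quantization error. -/
lemma hasDerivAt_gaussian_distortion_deriv {m : ℝ} (hm : m ≠ 0) (c : ℝ) (y : Fin N → ℝ)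
    (v : Fin N) :
    HasDerivAt
      (fun t => 2 * Real.sign m *
        (((t - c) * stdCDFE (stdBoundary (Rplus (Function.update y v t) v) c m)
            + m * stdPhiE (stdBoundary (Rplus (Function.update y v t) v) c m))
          - ((t - c) * stdCDFE (stdBoundary (Rminus (Function.update y v t) v) c m)
            + m * stdPhiE (stdBoundary (Rminus (Function.update y v t) v) c m))))
      (2 * Real.sign m *
          (stdCDFE (stdBoundary (Rplus y v) c m) - stdCDFE (stdBoundary (Rminus y v) c m))
        + (1 / (2 * |m|)) * stdPhiE (stdBoundary (Rplus y v) c m) * (y v - ynext y v)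
        + (1 / (2 * |m|)) * stdPhiE (stdBoundary (Rminus y v) c m) * (yprev y v - y v))
      (y v) := by
  refine (((hasDerivAt_Rplus_term hm c y v).sub
    (hasDerivAt_Rminus_term hm c y v)).const_mul (2 * Real.sign m)).congr_deriv ?_
  rcases lt_or_gt_of_ne hm with h | h
  · rw [Real.sign_of_neg h, abs_of_neg h]
    field_simp
    ring
  · rw [Real.sign_of_pos h, abs_of_pos h]
    field_simp
    ring

end Distortion

/-- **Main diagonal of the Hessian of the JRMQ distortion.** On the open set of strictly
increasing grids, the distortion `D(y) = Σ_{i,u} p_{i,u} E[min_v (m_{i,u}Z + c_u − y_v)²]`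
is twice partially differentiable in each coordinate and
`∂²D/∂(y_v)² = Σ_{i,u} p_{i,u} [2 sgn(m)(F_Z(r⁺) − F_Z(r⁻))
  + φ(r⁺)(y_v − y_{v+1})/(2|m|) + φ(r⁻)(y_{v−1} − y_v)/(2|m|)]`,
with terms involving an infinite standardized boundary vanishing via `φ(±∞) = 0`. -/
theorem jrmq_distortion_hessian_diagonal
    {Ω : Type*} [MeasurableSpace Ω] (P : Measure Ω) [IsProbabilityMeasure P]
    (Z : Ω → ℝ) (hZm : Measurable Z) (hZ : P.map Z = gaussianReal 0 1)
    {I U : Type*} [Fintype I] [Fintype U]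
    (N : ℕ) (hN : 1 ≤ N)
    (p : I → U → ℝ) (hp : ∀ i u, 0 ≤ p i u)
    (m : I → U → ℝ) (hm : ∀ i u, m i u ≠ 0)
    (c : U → ℝ)
    (D : (Fin N → ℝ) → ℝ)
    (hD : ∀ y : Fin N → ℝ,
      D y = ∑ i : I, ∑ u : U,
        p i u * ∫ ω, (⨅ v : Fin N, (m i u * Z ω + c u - y v) ^ 2) ∂P)
    (y : Fin N → ℝ) (hy : StrictMono y) (v : Fin N) :
    DifferentiableAt ℝ (fun t => D (Function.update y v t)) (y v) ∧
    HasDerivAt (fun t => deriv (fun s => D (Function.update y v s)) t)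
      (∑ i : I, ∑ u : U, p i u *
        (2 * Real.sign (m i u) *
            (stdCDFE (stdBoundary (Rplus y v) (c u) (m i u))
              - stdCDFE (stdBoundary (Rminus y v) (c u) (m i u)))
          + (1 / (2 * |m i u|)) * stdPhiE (stdBoundary (Rplus y v) (c u) (m i u))
              * (y v - ynext y v)
          + (1 / (2 * |m i u|)) * stdPhiE (stdBoundary (Rminus y v) (c u) (m i u))
              * (yprev y v - y v)))
      (y v) := by
  have hDt : ∀ t, D (Function.update y v t) = ∑ i : I, ∑ u : U, p i u *
      ∫ z, ⨅ w, (m i u * z + c u - Function.update y v t w) ^ 2 ∂gaussianReal 0 1 := by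
    intro t
    rw [hD]
    refine Finset.sum_congr rfl fun i _ => Finset.sum_congr rfl fun u _ => ?_
    have hmeas : Measurable fun z => ⨅ w, (m i u * z + c u - Function.update y v t w) ^ 2 :=
      Measurable.iInf fun w => by fun_prop
    rw [← hZ, integral_map hZm.aemeasurable hmeas.aestronglyMeasurable]
  have hderiv : ∀ t, StrictMono (Function.update y v t) → HasDerivAt
      (fun s => D (Function.update y v s))
      (∑ i : I, ∑ u : U, p i u * (2 * Real.sign (m i u) *
        (((t - c u) * stdCDFE (stdBoundary (Rplus (Function.update y v t) v) (c u) (m i u))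
            + m i u * stdPhiE (stdBoundary (Rplus (Function.update y v t) v) (c u) (m i u)))
          - ((t - c u) * stdCDFE (stdBoundary (Rminus (Function.update y v t) v) (c u) (m i u))
            + m i u *
              stdPhiE (stdBoundary (Rminus (Function.update y v t) v) (c u) (m i u)))))) t := by
    intro t ht
    simp_rw [hDt]
    refine HasDerivAt.fun_sum fun i _ => HasDerivAt.fun_sum fun u _ => ?_
    simpa using (hasDerivAt_gaussian_distortion (hm i u) (c u) ht v).const_mul (p i u)
  refine ⟨(hderiv (y v) (by simpa using hy)).differentiableAt, ?_⟩
  refine HasDerivAt.congr_of_eventuallyEq ?_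
    ((eventually_strictMono_update hy v).mono fun t ht => (hderiv t ht).deriv)
  exact HasDerivAt.fun_sum fun i _ => HasDerivAt.fun_sum fun u _ =>
    (hasDerivAt_gaussian_distortion_deriv (hm i u) (c u) y v).const_mul (p i u)
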